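/- (Proposition 4.4(ii), commutative kernel version.) In the Markov kernel semigroup setup, for every bounded measurable f : Ω → ℝ and every t > 0: sup_{x∈Ω} T_t((f − T_t f)²)(x) ≤ 4·‖f‖_{BMO_c(T)}² + sup_{x∈Ω} ( T_t f(x) − T_{2t} f(x) )². In particular, ‖f‖_{BMO_c^*(T)} ≤ 2·‖f‖_{BMO_c(T)} + sup_{t>0} sup_{x∈Ω} |T_t f(x) − T_{2t} f(x)|. -/

import Mathlib

open MeasureTheory ProbabilityTheory

/-- `T_t f(x) = ∫ f dκ_t(x)` for a family of kernels. -/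
noncomputable def Tker {Ω : Type*} [MeasurableSpace Ω] (κ : ℝ → Kernel Ω Ω)
    (t : ℝ) (f : Ω → ℝ) (x : Ω) : ℝ :=
  ∫ y, f y ∂(κ t x)

/-- Garsia-type BMO norm `‖f‖_{BMO_c(T)} = sup_{t>0} sup_x (T_t(f²)(x) − (T_t f(x))²)^{1/2}`. -/
noncomputable def bmoC {Ω : Type*} [MeasurableSpace Ω] (κ : ℝ → Kernel Ω Ω)
    (f : Ω → ℝ) : ℝ :=
  ⨆ t : Set.Ioi (0 : ℝ), ⨆ x : Ω,
    Real.sqrt (Tker κ t (fun y => f y ^ 2) x - (Tker κ t f x) ^ 2)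

/-- The BMO norm `‖f‖_{BMO_c^*(T)} = sup_{t>0} sup_x (T_t((f − T_t f)²)(x))^{1/2}`. -/
noncomputable def bmoCStar {Ω : Type*} [MeasurableSpace Ω] (κ : ℝ → Kernel Ω Ω)
    (f : Ω → ℝ) : ℝ :=
  ⨆ t : Set.Ioi (0 : ℝ), ⨆ x : Ω,
    Real.sqrt (Tker κ t (fun y => (f y - Tker κ t f y) ^ 2) x)

lemma abs_sq_le_sq_of_abs_le {Ω : Type*} {f : Ω → ℝ} {C : ℝ} (hC : ∀ x, |f x| ≤ C)
    (x : Ω) : |f x ^ 2| ≤ C ^ 2 := by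
  rw [abs_pow]
  exact pow_le_pow_left₀ (abs_nonneg _) (hC x) 2

section ProbabilityMeasure

variable {Ω : Type*} [MeasurableSpace Ω] {μ : Measure Ω} [IsProbabilityMeasure μ]

lemma integrable_of_abs_le {u : Ω → ℝ} (hu : Measurable u) {C : ℝ} (hC : ∀ x, |u x| ≤ C) :
    Integrable u μ :=
  .of_bound hu.aestronglyMeasurable C (.of_forall hC)

lemma integrable_sq_of_abs_le {u : Ω → ℝ} (hu : Measurable u) {C : ℝ} (hC : ∀ x, |u x| ≤ C) :
    Integrable (fun x => u x ^ 2) μ :=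
  integrable_of_abs_le (hu.pow_const 2) (abs_sq_le_sq_of_abs_le hC)

lemma abs_integral_le_of_abs_le {u : Ω → ℝ} {C : ℝ} (hC : ∀ x, |u x| ≤ C) :
    |∫ x, u x ∂μ| ≤ C := by
  simpa using norm_integral_le_of_norm_le_const (μ := μ) (f := u) (.of_forall hC)

lemma sq_integral_le_integral_sq {u : Ω → ℝ} (hu : Measurable u) {C : ℝ}
    (hC : ∀ x, |u x| ≤ C) : (∫ x, u x ∂μ) ^ 2 ≤ ∫ x, u x ^ 2 ∂μ := by
  have hL : MemLp u 2 μ := .of_bound hu.aestronglyMeasurable C (.of_forall hC)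
  have h := variance_nonneg u μ
  rw [variance_eq_sub hL] at h
  simpa using h

/-- The variance of a difference is at most twice the sum of the variances. -/
lemma integral_sub_sq_le {u v : Ω → ℝ} (hu : Measurable u) (hv : Measurable v) {C D : ℝ}
    (hC : ∀ x, |u x| ≤ C) (hD : ∀ x, |v x| ≤ D) :
    ∫ x, (u x - v x) ^ 2 ∂μ ≤
      2 * (∫ x, u x ^ 2 ∂μ - (∫ x, u x ∂μ) ^ 2) + 2 * (∫ x, v x ^ 2 ∂μ - (∫ x, v x ∂μ) ^ 2) +
        (∫ x, u x ∂μ - ∫ x, v x ∂μ) ^ 2 := by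
  have hadd : ∀ x, |u x + v x| ≤ C + D := fun x =>
    (abs_add_le _ _).trans (add_le_add (hC x) (hD x))
  have hsub : ∀ x, |u x - v x| ≤ C + D := fun x =>
    (abs_sub _ _).trans (add_le_add (hC x) (hD x))
  have hisub : Integrable (fun x => (u x - v x) ^ 2) μ :=
    integrable_sq_of_abs_le (hu.sub hv) hsub
  have hiadd : Integrable (fun x => (u x + v x) ^ 2) μ :=
    integrable_sq_of_abs_le (hu.add hv) hadd
  have hpar : ∫ x, (u x - v x) ^ 2 ∂μ + ∫ x, (u x + v x) ^ 2 ∂μ =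
      2 * ∫ x, u x ^ 2 ∂μ + 2 * ∫ x, v x ^ 2 ∂μ := by
    rw [← integral_add hisub hiadd, ← integral_const_mul, ← integral_const_mul,
      ← integral_add ((integrable_sq_of_abs_le hu hC).const_mul 2)
      ((integrable_sq_of_abs_le hv hD).const_mul 2)]
    congr 1 with x
    ring
  have hJ := sq_integral_le_integral_sq (μ := μ) (hu.add hv) hadd
  simp only [Pi.add_apply] at hJ
  rw [integral_add (integrable_of_abs_le hu hC) (integrable_of_abs_le hv hD)] at hJ
  linarith

end ProbabilityMeasure

section Tker

variable {Ω : Type*} [MeasurableSpace Ω] {κ : ℝ → Kernel Ω Ω} {f : Ω → ℝ} {C : ℝ}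

lemma measurable_Tker (t : ℝ) (hf : Measurable f) : Measurable (Tker κ t f) :=
  (hf.stronglyMeasurable.integral_kernel (κ := κ t)).measurable

lemma abs_Tker_le (hmk : ∀ t : ℝ, 0 < t → IsMarkovKernel (κ t)) {t : ℝ} (ht : 0 < t)
    (hC : ∀ x, |f x| ≤ C) (x : Ω) : |Tker κ t f x| ≤ C :=
  have := hmk t ht
  abs_integral_le_of_abs_le hC

lemma bmoC_nonneg : 0 ≤ bmoC κ f :=
  Real.iSup_nonneg fun _ => Real.iSup_nonneg fun _ => Real.sqrt_nonneg _

lemma Tker_sq_sub_sq_Tker_le (hmk : ∀ t : ℝ, 0 < t → IsMarkovKernel (κ t))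
    (hC : ∀ x, |f x| ≤ C) {t : ℝ} (ht : 0 < t) (x : Ω) :
    Tker κ t (fun y => f y ^ 2) x - (Tker κ t f x) ^ 2 ≤ bmoC κ f ^ 2 := by
  have hbd : ∀ (s : Set.Ioi (0 : ℝ)) (y : Ω),
      √(Tker κ s (fun y => f y ^ 2) y - (Tker κ s f y) ^ 2) ≤ √(C ^ 2) := fun s y => by
    have := (abs_le.1 (abs_Tker_le hmk s.2 (abs_sq_le_sq_of_abs_le hC) y)).2
    exact Real.sqrt_le_sqrt (by linarith [sq_nonneg (Tker κ s f y)])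
  refine Real.sqrt_le_left bmoC_nonneg |>.1 ?_
  refine (le_ciSup ⟨√(C ^ 2), Set.forall_mem_range.2 (hbd ⟨t, ht⟩)⟩ x).trans ?_
  exact le_ciSup (f := fun s : Set.Ioi (0 : ℝ) =>
      ⨆ y : Ω, √(Tker κ s (fun y => f y ^ 2) y - (Tker κ s f y) ^ 2))
    ⟨√(C ^ 2), Set.forall_mem_range.2 fun s =>
      Real.iSup_le (hbd s) (Real.sqrt_nonneg _)⟩ ⟨t, ht⟩

lemma Tker_sub_sq_le (hmk : ∀ t : ℝ, 0 < t → IsMarkovKernel (κ t))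
    (hsg : ∀ s t : ℝ, 0 < s → 0 < t → ∀ g : Ω → ℝ, Measurable g →
      (∃ C : ℝ, ∀ x, |g x| ≤ C) → Tker κ (s + t) g = Tker κ t (Tker κ s g))
    (hf : Measurable f) (hC : ∀ x, |f x| ≤ C) {t : ℝ} (ht : 0 < t) (x : Ω) :
    Tker κ t (fun y => (f y - Tker κ t f y) ^ 2) x ≤
      4 * bmoC κ f ^ 2 + (Tker κ t f x - Tker κ (2 * t) f x) ^ 2 := by
  have := hmk t ht
  have hg := measurable_Tker (κ := κ) t hf
  have hgC := abs_Tker_le hmk ht hC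
  have hf2 : Measurable fun y => f y ^ 2 := hf.pow_const 2
  have hf2C := abs_sq_le_sq_of_abs_le hC
  have h2f : Tker κ (2 * t) f = Tker κ t (Tker κ t f) := by
    rw [two_mul, hsg t t ht ht f hf ⟨C, hC⟩]
  have h2f2 : Tker κ (2 * t) (fun y => f y ^ 2) = Tker κ t (Tker κ t fun y => f y ^ 2) := by
    rw [two_mul, hsg t t ht ht _ hf2 ⟨C ^ 2, hf2C⟩]
  have hvar : Tker κ t (fun y => (f y - Tker κ t f y) ^ 2) x ≤
      2 * (Tker κ t (fun y => f y ^ 2) x - Tker κ t f x ^ 2) +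
      2 * (Tker κ t (fun y => Tker κ t f y ^ 2) x - Tker κ t (Tker κ t f) x ^ 2) +
      (Tker κ t f x - Tker κ t (Tker κ t f) x) ^ 2 :=
    integral_sub_sq_le hf hg hC hgC
  have hmono : Tker κ t (fun y => Tker κ t f y ^ 2) x ≤
      Tker κ t (Tker κ t fun y => f y ^ 2) x :=
    integral_mono (integrable_sq_of_abs_le hg hgC)
      (integrable_of_abs_le (measurable_Tker t hf2) (abs_Tker_le hmk ht hf2C))
      fun _ => sq_integral_le_integral_sq hf hC
  have h1 := Tker_sq_sub_sq_Tker_le hmk hC ht x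
  have h2 := Tker_sq_sub_sq_Tker_le hmk hC (mul_pos two_pos ht) x
  rw [h2f, h2f2] at h2
  rw [h2f]
  linarith

lemma abs_Tker_sub_Tker_le (hmk : ∀ t : ℝ, 0 < t → IsMarkovKernel (κ t))
    (hC : ∀ x, |f x| ≤ C) {s t : ℝ} (hs : 0 < s) (ht : 0 < t) (x : Ω) :
    |Tker κ s f x - Tker κ t f x| ≤ C + C :=
  (abs_sub _ _).trans (add_le_add (abs_Tker_le hmk hs hC x) (abs_Tker_le hmk ht hC x))

end Tker

/-- Proposition 4.4(ii), commutative kernel version: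
`sup_x T_t((f − T_t f)²)(x) ≤ 4‖f‖_{BMO_c(T)}² + sup_x (T_t f(x) − T_{2t} f(x))²`, and in
particular `‖f‖_{BMO_c^*(T)} ≤ 2‖f‖_{BMO_c(T)} + sup_{t>0} sup_x |T_t f(x) − T_{2t} f(x)|`. -/
theorem bmoCStar_le_bmoC {Ω : Type*} [MeasurableSpace Ω]
    (κ : ℝ → Kernel Ω Ω)
    (hmk : ∀ t : ℝ, 0 < t → IsMarkovKernel (κ t))
    (hsg : ∀ s t : ℝ, 0 < s → 0 < t → ∀ g : Ω → ℝ, Measurable g →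
      (∃ C : ℝ, ∀ x, |g x| ≤ C) → Tker κ (s + t) g = Tker κ t (Tker κ s g))
    (f : Ω → ℝ) (hf : Measurable f) (hfb : ∃ C : ℝ, ∀ x, |f x| ≤ C) :
    (∀ t : ℝ, 0 < t →
        (⨆ x : Ω, Tker κ t (fun y => (f y - Tker κ t f y) ^ 2) x) ≤
          4 * (bmoC κ f) ^ 2 + ⨆ x : Ω, (Tker κ t f x - Tker κ (2 * t) f x) ^ 2) ∧
      bmoCStar κ f ≤ 2 * bmoC κ f +
        ⨆ t : Set.Ioi (0 : ℝ), ⨆ x : Ω, |Tker κ t f x - Tker κ (2 * (t : ℝ)) f x| := by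
  obtain ⟨C, hC⟩ := hfb
  have hB : 0 ≤ bmoC κ f := bmoC_nonneg
  have hdiff : ∀ (t : Set.Ioi (0 : ℝ)) (x : Ω),
      |Tker κ t f x - Tker κ (2 * (t : ℝ)) f x| ≤ C + C := fun t x =>
    abs_Tker_sub_Tker_le hmk hC t.2 (mul_pos two_pos t.2) x
  have hD : 0 ≤ ⨆ t : Set.Ioi (0 : ℝ), ⨆ x : Ω, |Tker κ t f x - Tker κ (2 * (t : ℝ)) f x| :=
    Real.iSup_nonneg fun _ => Real.iSup_nonneg fun _ => abs_nonneg _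
  refine ⟨fun t ht => ?_, ?_⟩
  · refine Real.iSup_le (fun x => ?_) ?_
    · refine (Tker_sub_sq_le hmk hsg hf hC ht x).trans (add_le_add_right ?_ _)
      refine le_ciSup (f := fun x => (Tker κ t f x - Tker κ (2 * t) f x) ^ 2)
        ⟨(C + C) ^ 2, Set.forall_mem_range.2 fun y => ?_⟩ x
      exact (le_abs_self _).trans (abs_sq_le_sq_of_abs_le (hdiff ⟨t, ht⟩) y)
    · have : 0 ≤ ⨆ x : Ω, (Tker κ t f x - Tker κ (2 * t) f x) ^ 2 :=
        Real.iSup_nonneg fun _ => sq_nonneg _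
      positivity
  · refine Real.iSup_le (fun t => Real.iSup_le (fun x => ?_) ?_) ?_
    · have hx : |Tker κ t f x - Tker κ (2 * (t : ℝ)) f x| ≤
          ⨆ t : Set.Ioi (0 : ℝ), ⨆ x : Ω, |Tker κ t f x - Tker κ (2 * (t : ℝ)) f x| := by
        refine (le_ciSup ⟨C + C, Set.forall_mem_range.2 (hdiff t)⟩ x).trans ?_
        have hC0 : 0 ≤ C + C := (abs_nonneg _).trans (hdiff t x)
        exact le_ciSup (f := fun s : Set.Ioi (0 : ℝ) =>
            ⨆ x : Ω, |Tker κ s f x - Tker κ (2 * (s : ℝ)) f x|)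
          ⟨C + C, Set.forall_mem_range.2 fun s => Real.iSup_le (hdiff s) hC0⟩ t
      refine le_trans ?_ (add_le_add_right hx _)
      refine Real.sqrt_le_left (by positivity) |>.2 ?_
      refine (Tker_sub_sq_le hmk hsg hf hC t.2 x).trans ?_
      rw [add_sq, sq_abs, mul_pow]
      have : 0 ≤ 2 * (2 * bmoC κ f) * |Tker κ t f x - Tker κ (2 * (t : ℝ)) f x| := by positivity
      linarith
    · positivity
    · positivity
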